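/- arXiv:2603.14735 — 2 statements merged into one kernel-verified Lean document; each statement's English description precedes it below -/
import Mathlib

section
/- Let (N, ∘_λ) be a commutative associative conformal algebra and let D : N → N be a derivation, i.e., a ℂ-linear map with D∂ = ∂D and D(a∘_λ b) = D(a)∘_λ b + a∘_λ D(b) for all a, b. Define a∗_λ b = a∘_λ D(b). Then (N, ∘_λ, ∗_λ) is a Novikov-Poisson conformal algebra; in particular (a∘_λ b)∗_{λ+μ} c = a∘_λ(b∗_μ c) and (a∗_λ b)∘_{λ+μ} c − a∗_λ(b∘_μ c) = (b∗_μ a)∘_{λ+μ} c − b∗_μ(a∘_λ c) hold for all a, b, c ∈ N. -/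
/-!
We model a `ℂ[∂]`-module as a complex vector space `L` together with an
endomorphism `D` (the action of `∂`).  A `λ`-product (or `λ`-bracket) is a
`ℂ`-bilinear map `L → L → L[λ]`, where the polynomial `x ∘_λ y = Σₙ λⁿ • cₙ`
is encoded by its finitely supported family of coefficients `ℕ →₀ L`.
Substitution of the variable `λ` by a complex scalar, or by an operator such
as `-∂-λ`, is given by `ev`; since `ℂ` is infinite, an identity of
polynomials in (several) variables `λ, μ, γ` with coefficients in a complex
vector space holds formally if and only if it holds for all complex values
of the variables, which is how all identities are stated below.
-/

namespace ConfFormal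

variable {L : Type*} [AddCommGroup L] [Module ℂ L]

/-- Evaluation of a polynomial `p = Σₙ λⁿ • pₙ` with coefficients in `L`
(encoded as the family of its coefficients) at an endomorphism `T` of `L`
(for instance at a scalar `λ`, or at an operator such as `-∂-λ`). -/
noncomputable def ev (T : Module.End ℂ L) (p : ℕ →₀ L) : L :=
  p.sum fun n x => (T ^ n) x

/-- `app m T x y` is `x ∘_T y` : the `λ`-product `x ∘_λ y` recorded by the
`ℂ`-bilinear coefficient map `m`, with the variable `λ` substituted by the
endomorphism `T`. -/
noncomputable def app (m : L →ₗ[ℂ] L →ₗ[ℂ] (ℕ →₀ L)) (T : Module.End ℂ L) (x y : L) : L :=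
  ev T (m x y)

/-- The scalar `c` viewed as an endomorphism of `L`. -/
noncomputable def sc (c : ℂ) : Module.End ℂ L := c • (1 : Module.End ℂ L)

/-- `(L, D, m)` is a conformal algebra: conformal sesquilinearity holds. -/
structure IsConfAlg (D : Module.End ℂ L) (m : L →ₗ[ℂ] L →ₗ[ℂ] (ℕ →₀ L)) : Prop where
  sesq_left : ∀ (x y : L) (l : ℂ), app m (sc l) (D x) y = -l • app m (sc l) x y
  sesq_right : ∀ (x y : L) (l : ℂ),
    app m (sc l) x (D y) = D (app m (sc l) x y) + l • app m (sc l) x y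

/-- `(L, D, m)` is a commutative associative conformal algebra. -/
structure IsCommAssocConfAlg (D : Module.End ℂ L) (m : L →ₗ[ℂ] L →ₗ[ℂ] (ℕ →₀ L))
    extends IsConfAlg D m : Prop where
  assoc : ∀ (x y z : L) (l u : ℂ),
    app m (sc l) x (app m (sc u) y z) = app m (sc (l + u)) (app m (sc l) x y) z
  comm : ∀ (x y : L) (l : ℂ), app m (sc l) x y = app m (-(D + sc l)) y x

/-- `(L, D, br)` is a Lie conformal algebra. -/
structure IsLieConfAlg (D : Module.End ℂ L) (br : L →ₗ[ℂ] L →ₗ[ℂ] (ℕ →₀ L)) : Prop where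
  sesq_left : ∀ (x y : L) (l : ℂ), app br (sc l) (D x) y = -l • app br (sc l) x y
  skew : ∀ (x y : L) (l : ℂ), app br (sc l) x y = -app br (-(sc l + D)) y x
  jacobi : ∀ (x y z : L) (l u : ℂ),
    app br (sc l) x (app br (sc u) y z) =
      app br (sc (l + u)) (app br (sc l) x y) z + app br (sc u) y (app br (sc l) x z)

/-- `(L, D, m, br)` is a transposed Poisson conformal algebra. -/
structure IsTPCA (D : Module.End ℂ L) (m br : L →ₗ[ℂ] L →ₗ[ℂ] (ℕ →₀ L)) : Prop where
  commAssoc : IsCommAssocConfAlg D m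
  lie : IsLieConfAlg D br
  tLeibniz : ∀ (x y z : L) (l u : ℂ),
    (2 : ℂ) • app m (sc l) x (app br (sc u) y z) =
      app br (sc (l + u)) (app m (sc l) x y) z + app br (sc u) y (app m (sc l) x z)


/-- `(L, D, st)` is a left-symmetric (pre-Lie) conformal algebra. -/
structure IsLeftSymConfAlg (D : Module.End ℂ L) (st : L →ₗ[ℂ] L →ₗ[ℂ] (ℕ →₀ L))
    extends IsConfAlg D st : Prop where
  leftSym : ∀ (x y z : L) (l u : ℂ),
    app st (sc (l + u)) (app st (sc l) x y) z - app st (sc l) x (app st (sc u) y z)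
      = app st (sc (l + u)) (app st (sc u) y x) z - app st (sc u) y (app st (sc l) x z)

/-- `(L, D, st)` is a Novikov conformal algebra. -/
structure IsNovikovConfAlg (D : Module.End ℂ L) (st : L →ₗ[ℂ] L →ₗ[ℂ] (ℕ →₀ L))
    extends IsLeftSymConfAlg D st : Prop where
  novikov : ∀ (x y z : L) (l u : ℂ),
    app st (sc (l + u)) (app st (sc l) x y) z = app st (-(sc u + D)) (app st (sc l) x z) y

/-- `(L, D, m, st)` is a Novikov-Poisson conformal algebra. -/
structure IsNovikovPoissonConfAlg (D : Module.End ℂ L)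
    (m st : L →ₗ[ℂ] L →ₗ[ℂ] (ℕ →₀ L)) : Prop where
  commAssoc : IsCommAssocConfAlg D m
  novikov : IsNovikovConfAlg D st
  compat₁ : ∀ (x y z : L) (l u : ℂ),
    app st (sc (l + u)) (app m (sc l) x y) z = app m (sc l) x (app st (sc u) y z)
  compat₂ : ∀ (x y z : L) (l u : ℂ),
    app m (sc (l + u)) (app st (sc l) x y) z - app st (sc l) x (app m (sc u) y z)
      = app m (sc (l + u)) (app st (sc u) y x) z - app st (sc u) y (app m (sc l) x z)

/-- `Dd` is a derivation of the conformal algebra `(L, D, m)` : it commutes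
with `∂` and satisfies the Leibniz rule for the `λ`-product. -/
structure IsConfDerivation (D : Module.End ℂ L) (m : L →ₗ[ℂ] L →ₗ[ℂ] (ℕ →₀ L))
    (Dd : L →ₗ[ℂ] L) : Prop where
  comm_D : ∀ x : L, Dd (D x) = D (Dd x)
  leibniz : ∀ (x y : L) (l : ℂ),
    Dd (app m (sc l) x y) = app m (sc l) (Dd x) y + app m (sc l) x (Dd y)

theorem ev_add (T : Module.End ℂ L) (p q : ℕ →₀ L) : ev T (p + q) = ev T p + ev T q :=
  Finsupp.sum_add_index' (fun n => map_zero (T ^ n)) (fun n => map_add (T ^ n))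

theorem ev_smul (T : Module.End ℂ L) (c : ℂ) (p : ℕ →₀ L) : ev T (c • p) = c • ev T p := by
  unfold ev
  rw [Finsupp.sum_smul_index' (fun n => map_zero (T ^ n)), Finsupp.smul_sum]
  simp only [map_smul]

theorem sc_pow_apply (c : ℂ) (n : ℕ) (x : L) : (sc c ^ n : Module.End ℂ L) x = c ^ n • x := by
  simp [sc, smul_pow]

/-- A family of coefficients is determined by its evaluations at all scalars. -/
theorem eq_of_forall_ev_sc {p q : ℕ →₀ L} (h : ∀ l : ℂ, ev (sc l) p = ev (sc l) q) : p = q := by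
  ext n
  rw [← sub_eq_zero, ← Module.forall_dual_apply_eq_zero_iff ℂ]
  intro f
  have eval_eq (r : ℕ →₀ L) (l : ℂ) :
      (r.sum fun k x => Polynomial.monomial k (f x)).eval l = f (ev (sc l) r) := by
    simp [ev, Finsupp.sum, Polynomial.eval_finsetSum, sc_pow_apply, mul_comm]
  have coeff_eq (r : ℕ →₀ L) :
      (r.sum fun k x => Polynomial.monomial k (f x)).coeff n = f (r n) := by
    simp +contextual [Finsupp.sum, Polynomial.coeff_monomial]
  have key : (p.sum fun k x => Polynomial.monomial k (f x)) =
      q.sum fun k x => Polynomial.monomial k (f x) :=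
    Polynomial.funext fun l => by rw [eval_eq, eval_eq, h]
  rw [map_sub, ← coeff_eq, ← coeff_eq, key, sub_self]

theorem app_add_right (m : L →ₗ[ℂ] L →ₗ[ℂ] (ℕ →₀ L)) (T : Module.End ℂ L) (x y z : L) :
    app m T x (y + z) = app m T x y + app m T x z := by
  simp only [app, map_add, ev_add]

/-- The map `x ↦ x ∘_T y` as a linear map. -/
noncomputable def appLeft (m : L →ₗ[ℂ] L →ₗ[ℂ] (ℕ →₀ L)) (T : Module.End ℂ L) (y : L) :
    L →ₗ[ℂ] L where
  toFun x := app m T x y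
  map_add' x z := by simp only [app, map_add, LinearMap.add_apply, ev_add]
  map_smul' c x := by simp only [app, map_smul, LinearMap.smul_apply, ev_smul, RingHom.id_apply]

/-- A linear map sending the action of `T` to multiplication by `c` does not distinguish
evaluation at `T` from evaluation at the scalar `c`. -/
theorem map_ev_eq_map_ev_sc (F : L →ₗ[ℂ] L) (T : Module.End ℂ L) (c : ℂ)
    (hF : ∀ x, F (T x) = c • F x) (p : ℕ →₀ L) : F (ev T p) = F (ev (sc c) p) := by
  have hpow (n : ℕ) (x : L) : F ((T ^ n) x) = c ^ n • F x := by
    induction n with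
    | zero => simp
    | succ n ih => rw [pow_succ', Module.End.mul_apply, hF, ih, smul_smul, pow_succ']
  simp only [ev, Finsupp.sum, map_sum, hpow, sc_pow_apply, map_smul]

namespace IsCommAssocConfAlg

variable {D : Module.End ℂ L} {m : L →ₗ[ℂ] L →ₗ[ℂ] (ℕ →₀ L)}

theorem app_app_comm (hm : IsCommAssocConfAlg D m) (x y z : L) (l u : ℂ) :
    app m (sc (l + u)) (app m (sc l) x y) z = app m (sc (l + u)) (app m (sc u) y x) z := by
  rw [hm.comm x y l]
  refine map_ev_eq_map_ev_sc (appLeft m (sc (l + u)) z) _ u (fun w => ?_) (m y x)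
  have hD : appLeft m (sc (l + u)) z (D w) = -(l + u) • appLeft m (sc (l + u)) z w :=
    hm.sesq_left w z (l + u)
  have hT : (-(D + sc l) : Module.End ℂ L) w = -(D w + l • w) := rfl
  rw [hT, map_neg, map_add, hD, map_smul]
  module

theorem left_comm (hm : IsCommAssocConfAlg D m) (x y z : L) (l u : ℂ) :
    app m (sc l) x (app m (sc u) y z) = app m (sc u) y (app m (sc l) x z) := by
  rw [hm.assoc, hm.assoc, hm.app_app_comm, add_comm]

end IsCommAssocConfAlg

/-- If `D` is a derivation of a commutative associative
conformal algebra `(N, ∘_λ)`, then with `a∗_λ b = a∘_λ D(b)` the triple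
`(N, ∘_λ, ∗_λ)` is a Novikov-Poisson conformal algebra. -/
theorem derivation_novikovPoisson {L : Type*} [AddCommGroup L] [Module ℂ L]
    (D : Module.End ℂ L) (m : L →ₗ[ℂ] L →ₗ[ℂ] (ℕ →₀ L))
    (hm : IsCommAssocConfAlg D m)
    (Dd : L →ₗ[ℂ] L) (hDd : IsConfDerivation D m Dd)
    (st : L →ₗ[ℂ] L →ₗ[ℂ] (ℕ →₀ L))
    (hst : ∀ (a b : L) (l : ℂ), app st (sc l) a b = app m (sc l) a (Dd b)) :
    IsNovikovPoissonConfAlg D m st := by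
  have hst' (T : Module.End ℂ L) (a b : L) : app st T a b = app m T a (Dd b) :=
    congrArg (ev T) (eq_of_forall_ev_sc (hst a b))
  refine ⟨hm, ⟨⟨⟨?_, ?_⟩, ?_⟩, ?_⟩, ?_, ?_⟩
  · intro x y l
    simp only [hst', hm.sesq_left]
  · intro x y l
    simp only [hst', hDd.comm_D, hm.sesq_right]
  · intro x y z l u
    have h₁ := hm.left_comm x y (Dd (Dd z)) l u
    have h₂ := hm.assoc x (Dd y) (Dd z) l u
    have h₃ := hm.assoc y (Dd x) (Dd z) u l
    rw [add_comm u l] at h₃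
    simp only [hst', hDd.leibniz, app_add_right, h₁, ← h₂, ← h₃]
    abel
  · intro x y z l u
    rw [add_comm (sc u) D]
    simp only [hst']
    rw [← hm.comm, ← hm.assoc, hm.left_comm]
  · intro x y z l u
    simp only [hst', hm.assoc]
  · intro x y z l u
    have h₁ := hm.left_comm x y (Dd z) l u
    have h₂ := hm.assoc x (Dd y) z l u
    have h₃ := hm.assoc y (Dd x) z u l
    rw [add_comm u l] at h₃
    simp only [hst', hDd.leibniz, app_add_right, h₁, ← h₂, ← h₃]
    abel

end ConfFormal
end

section
/- Let c₀ ∈ ℂ and let p, s, l be polynomials in one variable λ over ℂ satisfying, as identities of polynomials in two variables λ, μ over ℂ: (i) c₀l(λ) + c₀l(μ) = c₀l(λ+μ); (ii) c₀s(μ) + p(μ)l(λ) = c₀s(λ+μ) + l(λ)l(λ+μ); (iii) c₀l(λ) + c₀p(λ+μ) = c₀p(μ); (iv) p(λ)l(μ) + c₀s(λ) = p(λ)l(λ+μ); (v) p(λ)s(μ) + p(μ)s(λ) = p(λ)s(λ+μ) + s(λ)l(λ+μ); (vi) p(λ)p(λ+μ) + c₀s(λ) = p(λ)p(μ). Then (c₀,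 p, s, l) belongs to one of the following four families: (B1) c₀ = 0, p = 0, l = 0, and s arbitrary; (B2) c₀ = 0, p = c₁ a nonzero constant, l = 0, and s(λ) = c₂λ for some c₂ ∈ ℂ; (B3) c₀ = 0, p = l = c₁ a nonzero constant, and s = c₃ a constant; (B4) c₀ ≠ 0, l(λ) = kλ, p(λ) = m − kλ, and s(λ) = (km/c₀)λ − (k²/c₀)λ² for some m, k ∈ ℂ. -/
open Polynomial

/-- An additive polynomial function over a field of characteristic zero is linear. -/
theorem eq_C_mul_X_of_eval_add {K : Type*} [Field K] [CharZero K] (f : Polynomial K)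
    (h : ∀ x y : K, f.eval (x + y) = f.eval x + f.eval y) : f = C (f.eval 1) * X := by
  have hnat (n : ℕ) : f.eval (n : K) = f.eval 1 * n := by
    induction n with
    | zero => simpa using h 0 0
    | succ n ih => push_cast; rw [h, ih]; ring
  refine eq_of_infinite_eval_eq _ _ ((Set.infinite_range_of_injective
    (Nat.cast_injective (R := K))).mono ?_)
  rintro _ ⟨n, rfl⟩
  simp [hnat]

/-- Classification of the solutions `(c₀, p, s, l)` of the
system of polynomial functional equations (i)–(vi) arising in the study of
compatible noncommutative transposed Poisson conformal algebra structures on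
`W(a,b)`.  The identities in `ℂ[λ,μ]` are stated via evaluation at all
complex points, which is equivalent since `ℂ` is infinite. -/
theorem classification_polynomial_system
    (c₀ : ℂ) (p s l : Polynomial ℂ)
    (h1 : ∀ x y : ℂ, c₀ * l.eval x + c₀ * l.eval y = c₀ * l.eval (x + y))
    (h2 : ∀ x y : ℂ,
      c₀ * s.eval y + p.eval y * l.eval x = c₀ * s.eval (x + y) + l.eval x * l.eval (x + y))
    (h3 : ∀ x y : ℂ, c₀ * l.eval x + c₀ * p.eval (x + y) = c₀ * p.eval y)
    (h4 : ∀ x y : ℂ, p.eval x * l.eval y + c₀ * s.eval x = p.eval x * l.eval (x + y))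
    (h5 : ∀ x y : ℂ,
      p.eval x * s.eval y + p.eval y * s.eval x
        = p.eval x * s.eval (x + y) + s.eval x * l.eval (x + y))
    (h6 : ∀ x y : ℂ, p.eval x * p.eval (x + y) + c₀ * s.eval x = p.eval x * p.eval y) :
    -- (B1)
    (c₀ = 0 ∧ p = 0 ∧ l = 0) ∨
    -- (B2)
    (c₀ = 0 ∧ ∃ c₁ : ℂ, c₁ ≠ 0 ∧ p = C c₁ ∧ l = 0 ∧ ∃ c₂ : ℂ, s = C c₂ * X) ∨
    -- (B3)
    (c₀ = 0 ∧ ∃ c₁ : ℂ, c₁ ≠ 0 ∧ p = C c₁ ∧ l = C c₁ ∧ ∃ c₃ : ℂ, s = C c₃) ∨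
    -- (B4)
    (c₀ ≠ 0 ∧ ∃ m k : ℂ, l = C k * X ∧ p = C m - C k * X ∧
      s = C (k * m / c₀) * X - C (k ^ 2 / c₀) * X ^ 2) := by
  by_cases hc : c₀ = 0
  · subst hc
    simp only [zero_mul, zero_add, add_zero] at h2 h4 h6
    by_cases hp : p = 0
    · refine .inl ⟨rfl, hp, Polynomial.funext fun x => ?_⟩
      simpa [hp] using h2 x 0
    have hpC : p = C (p.eval 0) := by
      have : p * (p - C (p.eval 0)) = 0 := Polynomial.funext fun x => by
        have := h6 x 0
        simp only [add_zero] at this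
        simp [mul_sub, this]
      exact sub_eq_zero.mp ((mul_eq_zero.mp this).resolve_left hp)
    generalize p.eval 0 = c₁ at hpC
    subst hpC
    have hc₁ : c₁ ≠ 0 := fun h => hp (by simp [h])
    simp only [eval_C] at h2 h4 h5
    have hlC : l = C (l.eval 0) := Polynomial.funext fun x => by
      simpa using (mul_left_cancel₀ hc₁ (h4 x 0)).symm
    generalize l.eval 0 = d at hlC
    subst hlC
    simp only [eval_C] at h2 h5
    by_cases hd : d = 0
    · subst hd
      refine .inr (.inl ⟨rfl, c₁, hc₁, rfl, by simp, s.eval 1,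
        eq_C_mul_X_of_eval_add s fun x y => mul_left_cancel₀ hc₁ ?_⟩)
      linear_combination -h5 x y
    · obtain rfl : c₁ = d := mul_right_cancel₀ hd (h2 0 0)
      refine .inr (.inr (.inl ⟨rfl, c₁, hc₁, rfl, rfl, s.eval 0,
        Polynomial.funext fun x => mul_left_cancel₀ hc₁ ?_⟩))
      have := h5 x 0
      simp only [add_zero] at this
      rw [eval_C]
      linear_combination -this
  · have hl : l = C (l.eval 1) * X := eq_C_mul_X_of_eval_add l fun x y =>
      mul_left_cancel₀ hc (by linear_combination -h1 x y)
    generalize l.eval 1 = k at hl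
    subst hl
    have hp (x : ℂ) : p.eval x = p.eval 0 - k * x := mul_left_cancel₀ hc <| by
      have := h3 x 0
      simp only [eval_mul, eval_C, eval_X, add_zero] at this
      linear_combination this
    refine .inr (.inr (.inr ⟨hc, p.eval 0, k, rfl, Polynomial.funext fun x => ?_,
      Polynomial.funext fun x => ?_⟩))
    · simpa using hp x
    · have := h4 x 0
      rw [hp x] at this
      simp only [eval_mul, eval_C, eval_X, eval_sub, eval_pow, add_zero, mul_zero,
        zero_add] at this ⊢
      field_simp
      linear_combination this
end
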